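/- Assume (A1)–(A3) and (A6)–(A7), let q* ∈ [q₁, q₂) be the threshold value (so that c_NL*(q) = c₀* for q ∈ [0, q*] and c_NL*(q) > c₀* for q > q*), and let 𝒲* be the minimal nonlocal traveling wave for parameter q* with speed c₀*. If lim_{ξ→+∞} 𝒲*(ξ)/(ξ e^{−λ₀ξ}) = A₀ for some A₀ > 0, then there exists a continuous function ℛ_w : ℝ → ℝ with ℛ_w(ξ) = O(ξ e^{−λ₀ξ}) as ξ → +∞ such that for all sufficiently small δ₀ > 0 the function 𝒲̄(ξ) := min{𝒲*(ξ) − ℛ_w(ξ), 1} is nonnegative and not identically zero, and there is a finite set S ⊂ ℝ such that 𝒲̄ is C¹ on ℝ∖S and satisfies J∗𝒲̄ − 𝒲̄ + c₀*𝒲̄' + f(𝒲̄; q* + δ₀) ≤ 0 on ℝ∖S, while at each ξ₀ ∈ S the one-sided derivatives 𝒲̄'(ξ₀⁺) and 𝒲̄'(ξ₀⁻) exist and satisfy 𝒲̄'(ξ₀⁺) ≤ 𝒲̄'(ξ₀⁻). -/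

import Mathlib

open Filter Asymptotics MeasureTheory Set

noncomputable section

/-- A continuous, nonnegative, even, compactly supported dispersal kernel of total mass 1. -/
def IsKernel (J : ℝ → ℝ) : Prop :=
  Continuous J ∧ (∀ x, 0 ≤ J x) ∧ (∀ x, J (-x) = J x) ∧
  HasCompactSupport J ∧ (∫ x, J x) = 1

/-- A nonlocal traveling wave front with speed `c` for the kernel `J` and nonlinearity `g`. -/
def IsNLFront (J : ℝ → ℝ) (g : ℝ → ℝ) (c : ℝ) (W : ℝ → ℝ) : Prop :=
  ContDiff ℝ 1 W ∧
  (∀ ξ, (∫ y, J (ξ - y) * W y) - W ξ + c * deriv W ξ + g (W ξ) = 0) ∧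
  Tendsto W atBot (nhds 1) ∧ Tendsto W atTop (nhds 0) ∧
  (∀ ξ, deriv W ξ < 0)

/-- The linearized minimal speed `c₀* = inf_{λ>0} (∫ J(x)e^{λx}dx + γ₀ - 1)/λ`. -/
noncomputable def c0star (J : ℝ → ℝ) (γ₀ : ℝ) : ℝ :=
  sInf ((fun l : ℝ => ((∫ x, J x * Real.exp (l * x)) + γ₀ - 1) / l) '' Ioi 0)

lemma mvt01 (F : ℝ → ℝ) (hF : DifferentiableOn ℝ F (Icc 0 1)) (x y : ℝ) (hx : 0 ≤ x)
    (hxy : x < y) (hy : y ≤ 1) :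
    ∃ c ∈ Ioo x y, F y - F x = derivWithin F (Icc 0 1) c * (y - x) := by
  have hsub : Icc x y ⊆ Icc 0 1 := Icc_subset_Icc hx hy
  obtain ⟨c, hc, h⟩ := exists_deriv_eq_slope F hxy (hF.continuousOn.mono hsub)
    ((hF.mono hsub).mono Ioo_subset_Icc_self)
  refine ⟨c, hc, ?_⟩
  have hn : Icc (0:ℝ) 1 ∈ nhds c :=
    Icc_mem_nhds (lt_of_le_of_lt hx hc.1) (lt_of_lt_of_le hc.2 hy)
  rw [derivWithin_of_mem_nhds hn, h]
  have : y - x ≠ 0 := by linarith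
  field_simp

lemma f_facts (F : ℝ → ℝ) (γ₀ : ℝ) (hF : ContDiffOn ℝ 2 F (Icc 0 1))
    (h0 : derivWithin F (Icc 0 1) 0 = γ₀) (h1 : derivWithin F (Icc 0 1) 1 < 0) :
    ∃ K a ρ : ℝ, 0 < a ∧ a ≤ K ∧ 0 < ρ ∧ ρ ≤ 1 ∧
      (∀ x y, 0 ≤ x → x ≤ y → y ≤ 1 → |F y - F x| ≤ K * (y - x)) ∧
      (∀ x y, 1 - ρ ≤ x → x ≤ y → y ≤ 1 → F y - F x ≤ -a * (y - x)) ∧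
      (∀ x y, 0 ≤ x → x ≤ y → y ≤ 1 → (γ₀ - K * y) * (y - x) ≤ F y - F x) := by
  set G := derivWithin F (Icc 0 1) with hG
  have hu : UniqueDiffOn ℝ (Icc (0:ℝ) 1) := uniqueDiffOn_Icc one_pos
  have hFd : DifferentiableOn ℝ F (Icc 0 1) := hF.differentiableOn (by norm_num)
  have hGc : ContDiffOn ℝ 1 G (Icc 0 1) := hF.derivWithin hu (by norm_num)
  have hGd : DifferentiableOn ℝ G (Icc 0 1) := hGc.differentiableOn (by norm_num)
  have hG2 : ContinuousOn (derivWithin G (Icc 0 1)) (Icc 0 1) :=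
    (hGc.derivWithin (m := 0) hu (by norm_num)).continuousOn
  obtain ⟨K1, hK1⟩ := isCompact_Icc.exists_bound_of_continuousOn hGd.continuousOn
  obtain ⟨K2, hK2⟩ := isCompact_Icc.exists_bound_of_continuousOn hG2
  have hGlim := (hGd.continuousOn 1 (by simp)) 
  have hev : ∀ᶠ x in nhdsWithin 1 (Icc (0:ℝ) 1), G x < G 1 / 2 :=
    hGlim.eventually_lt_const (by linarith)
  obtain ⟨ρ, hρ, hb⟩ := Metric.mem_nhdsWithin_iff.1 hev
  have hmvt : ∀ x y, 0 ≤ x → x ≤ y → y ≤ 1 → ∃ c ∈ Icc x y, F y - F x = G c * (y - x) := by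
    intro x y hx hxy hy
    rcases hxy.eq_or_lt with rfl | h
    · exact ⟨x, by simp, by simp⟩
    · obtain ⟨c, hc, h⟩ := mvt01 F hFd x y hx h hy
      exact ⟨c, Ioo_subset_Icc_self hc, h⟩
  refine ⟨max (max K1 K2) (-(G 1) / 2), -(G 1) / 2, min (ρ / 2) 1, by linarith, le_max_right _ _,
    by positivity, min_le_right _ _, ?_, ?_, ?_⟩
  · intro x y hx hxy hy
    obtain ⟨c, hc, h⟩ := hmvt x y hx hxy hy
    rw [h, abs_mul, abs_of_nonneg (sub_nonneg.2 hxy)]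
    apply mul_le_mul_of_nonneg_right _ (sub_nonneg.2 hxy)
    exact (hK1 c ⟨hx.trans hc.1, hc.2.trans hy⟩).trans ((le_max_left _ _).trans (le_max_left _ _))
  · intro x y hx hxy hy
    have m1 := min_le_right (ρ / 2) 1
    have m2 := min_le_left (ρ / 2) 1
    obtain ⟨c, hc, h⟩ := hmvt x y (by linarith) hxy hy
    rw [h]
    apply mul_le_mul_of_nonneg_right _ (sub_nonneg.2 hxy)
    have hc1 := hc.1
    have hc2 := hc.2
    have : G c < G 1 / 2 := hb ⟨by
      rw [Metric.mem_ball, Real.dist_eq, abs_lt]; constructor <;> linarith,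
      by constructor <;> linarith⟩
    linarith
  · intro x y hx hxy hy
    obtain ⟨c, hc, h⟩ := hmvt x y hx hxy hy
    rw [h]
    apply mul_le_mul_of_nonneg_right _ (sub_nonneg.2 hxy)
    have hc0 : 0 ≤ c := hx.trans hc.1
    have hc1 : c ≤ 1 := hc.2.trans hy
    rcases hc0.eq_or_lt with h' | h'
    · rw [← h', h0]
      have : 0 ≤ max (max K1 K2) (-(G 1) / 2) := le_max_of_le_right (by linarith)
      have := mul_nonneg this (hx.trans hxy)
      linarith
    · obtain ⟨d, hd, hh⟩ := mvt01 G hGd 0 c le_rfl h' hc1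
      have k2 := hK2 d ⟨hd.1.le, hd.2.le.trans hc1⟩
      rw [Real.norm_eq_abs] at k2
      have k3 := neg_abs_le (derivWithin G (Icc 0 1) d)
      have k4 : K2 ≤ max (max K1 K2) (-(G 1) / 2) := (le_max_right _ _).trans (le_max_left _ _)
      have hc2 := hc.2
      have k5 : 0 ≤ K2 := (abs_nonneg _).trans k2
      rw [h0] at hh
      have : -(max (max K1 K2) (-(G 1) / 2)) * y ≤ derivWithin G (Icc 0 1) d * (c - 0) := by
        have e1 : K2 * c ≤ max (max K1 K2) (-(G 1) / 2) * y := by gcongr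
        have e2 : -K2 * c ≤ derivWithin G (Icc 0 1) d * c := by
          apply mul_le_mul_of_nonneg_right _ hc0; linarith
        rw [sub_zero]; linarith
      linarith

lemma f_diff (A B : ℝ → ℝ) (γ₀ L : ℝ) (hA : ContDiffOn ℝ 2 A (Icc 0 1))
    (hB : ContDiffOn ℝ 2 B (Icc 0 1)) (a0 : A 0 = 0) (b0 : B 0 = 0)
    (ha : derivWithin A (Icc 0 1) 0 = γ₀) (hb : derivWithin B (Icc 0 1) 0 = γ₀)
    (h : ∀ w ∈ Icc (0:ℝ) 1, |iteratedDerivWithin 2 A (Icc 0 1) w -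
        iteratedDerivWithin 2 B (Icc 0 1) w| ≤ L) (w : ℝ) (hw0 : 0 ≤ w) (hw1 : w ≤ 1) :
    A w ≤ B w + L * w ^ 2 := by
  have hu : UniqueDiffOn ℝ (Icc (0:ℝ) 1) := uniqueDiffOn_Icc one_pos
  rcases hw0.eq_or_lt with h' | h'
  · rw [← h', a0, b0]; simp
  have hL : 0 ≤ L := (abs_nonneg _).trans (h 0 (by simp))
  have hAd : DifferentiableOn ℝ A (Icc 0 1) := hA.differentiableOn (by norm_num)
  have hBd : DifferentiableOn ℝ B (Icc 0 1) := hB.differentiableOn (by norm_num)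
  have hAd' : DifferentiableOn ℝ (derivWithin A (Icc 0 1)) (Icc 0 1) :=
    (hA.derivWithin (m := 1) hu (by norm_num)).differentiableOn (by norm_num)
  have hBd' : DifferentiableOn ℝ (derivWithin B (Icc 0 1)) (Icc 0 1) :=
    (hB.derivWithin (m := 1) hu (by norm_num)).differentiableOn (by norm_num)
  obtain ⟨c, hc, e1⟩ := mvt01 (fun x => A x - B x) (hAd.sub hBd) 0 w le_rfl h' hw1
  have hcm : c ∈ Icc (0:ℝ) 1 := ⟨hc.1.le, hc.2.le.trans hw1⟩
  obtain ⟨d, hd, e2⟩ := mvt01 (fun x => derivWithin A (Icc 0 1) x - derivWithin B (Icc 0 1) x)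
    (hAd'.sub hBd') 0 c le_rfl hc.1 hcm.2
  have hdm : d ∈ Icc (0:ℝ) 1 := ⟨hd.1.le, hd.2.le.trans hcm.2⟩
  have hh := h d hdm
  have i2 : ∀ F : ℝ → ℝ, iteratedDerivWithin 2 F (Icc 0 1) d =
      derivWithin (derivWithin F (Icc 0 1)) (Icc 0 1) d := by
    intro F
    rw [iteratedDerivWithin_succ, iteratedDerivWithin_one]
  rw [i2, i2] at hh
  rw [derivWithin_fun_sub (hAd c hcm) (hBd c hcm)] at e1
  rw [derivWithin_fun_sub (hAd' d hdm) (hBd' d hdm)] at e2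
  simp only [ha, hb, a0, b0, sub_self, sub_zero] at e1 e2
  have hh2 := (abs_le.1 hh).2
  have t1 : derivWithin A (Icc 0 1) c - derivWithin B (Icc 0 1) c ≤ L * c := by
    rw [e2]; exact mul_le_mul_of_nonneg_right hh2 hcm.1
  have t2 : L * c ≤ L * w := mul_le_mul_of_nonneg_left hc.2.le hL
  have t3 := mul_le_mul_of_nonneg_right (t1.trans t2) hw0
  nlinarith

lemma kint (J : ℝ → ℝ) (hJ : IsKernel J) (u : ℝ → ℝ) (hu : Continuous u) (ξ : ℝ) :
    Integrable (fun y => J (ξ - y) * u y) := by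
  have hc : Continuous (fun y => J (ξ - y) * u y) := by
    have := hJ.1; fun_prop
  apply hc.integrable_of_hasCompactSupport
  apply HasCompactSupport.mul_right
  exact hJ.2.2.2.1.comp_homeomorph (Homeomorph.subLeft ξ)

lemma kint' (J : ℝ → ℝ) (hJ : IsKernel J) (u : ℝ → ℝ) (hu : Continuous u) :
    Integrable (fun y => J y * u y) := by
  have hc : Continuous (fun y => J y * u y) := by
    have := hJ.1; fun_prop
  exact hc.integrable_of_hasCompactSupport hJ.2.2.2.1.mul_right

lemma krad (J : ℝ → ℝ) (hJ : IsKernel J) : ∃ r > 0, ∀ x, r < |x| → J x = 0 := by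
  obtain ⟨r, hr⟩ := hJ.2.2.2.1.isCompact.isBounded.subset_closedBall 0
  refine ⟨max r 1, by positivity, fun x hx => ?_⟩
  by_contra h
  have := hr (subset_tsupport _ h)
  rw [Metric.mem_closedBall, Real.dist_eq, sub_zero] at this
  have := le_max_left r 1
  linarith

lemma kmono (J : ℝ → ℝ) (hJ : IsKernel J) (r : ℝ) (hr : ∀ x, r < |x| → J x = 0)
    (u v : ℝ → ℝ) (hu : Continuous u) (hv : Continuous v) (ξ : ℝ)
    (h : ∀ y, |ξ - y| ≤ r → u y ≤ v y) :
    ∫ y, J (ξ - y) * u y ≤ ∫ y, J (ξ - y) * v y := by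
  apply integral_mono (kint J hJ u hu ξ) (kint J hJ v hv ξ)
  intro y
  by_cases hy : |ξ - y| ≤ r
  · exact mul_le_mul_of_nonneg_left (h y hy) (hJ.2.1 _)
  · simp [hr _ (not_le.1 hy)]

lemma kone (J : ℝ → ℝ) (hJ : IsKernel J) (ξ : ℝ) : ∫ y, J (ξ - y) = 1 := by
  rw [integral_sub_left_eq_self (fun y => J y), hJ.2.2.2.2]

lemma kexp (J : ℝ → ℝ) (ξ b l : ℝ) :
    ∫ y, J (ξ - y) * Real.exp (-(l * (y - b))) =
      (∫ x, J x * Real.exp (l * x)) * Real.exp (-(l * (ξ - b))) := by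
  rw [← integral_sub_left_eq_self (fun y => J y * Real.exp (l * y)) volume ξ, ← integral_mul_const]
  congr 1; ext y
  rw [mul_assoc, ← Real.exp_add]
  congr 2; ring

lemma kxexp (J : ℝ → ℝ) (hJ : IsKernel J) (ξ b l : ℝ) :
    ∫ y, J (ξ - y) * ((y - b) * Real.exp (-(l * (y - b)))) =
      ((ξ - b) * (∫ x, J x * Real.exp (l * x)) - ∫ x, J x * (x * Real.exp (l * x)))
        * Real.exp (-(l * (ξ - b))) := by
  rw [← integral_const_mul, ← integral_sub, 
    ← integral_sub_left_eq_self (fun x => (ξ - b) * (J x * Real.exp (l * x)) - J x * (x * Real.exp (l * x))) volume ξ, ← integral_mul_const]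
  · congr 1; ext y
    have : Real.exp (-(l * (y - b))) = Real.exp (l * (ξ - y)) * Real.exp (-(l * (ξ - b))) := by
      rw [← Real.exp_add]; congr 1; ring
    rw [this]; ring
  · exact (kint' J hJ _ (by fun_prop)).const_mul _
  · exact (kint' J hJ _ (by fun_prop))

lemma kmgf (J : ℝ → ℝ) (hJ : IsKernel J) (l : ℝ) : 1 ≤ ∫ x, J x * Real.exp (l * x) := by
  have hodd : ∫ x, J x * x = 0 := by
    have h := integral_neg_eq_self (fun x => J x * x) volume
    have h2 : ∫ x, J (-x) * (-x) = - ∫ x, J x * x := by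
      rw [← integral_neg]; congr 1; ext x; rw [hJ.2.2.1]; ring
    linarith
  have : ∫ x, J x * (1 + l * x) = 1 := by
    have : (fun x => J x * (1 + l * x)) = fun x => J x * 1 + l * (J x * x) := by ext; ring
    rw [this, integral_add (kint' J hJ _ (by fun_prop))
      ((kint' J hJ (fun x => x) (by fun_prop)).const_mul _), integral_const_mul, hodd]
    simp [hJ.2.2.2.2]
  rw [← this]
  apply integral_mono (kint' J hJ _ (by fun_prop)) (kint' J hJ _ (by fun_prop))
  intro x
  have := Real.add_one_le_exp (l * x)
  exact mul_le_mul_of_nonneg_left (by linarith) (hJ.2.1 _)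

lemma c0_le (J : ℝ → ℝ) (hJ : IsKernel J) (γ₀ : ℝ) (hγ : 0 < γ₀) (l : ℝ) (hl : 0 < l) :
    c0star J γ₀ * l ≤ (∫ x, J x * Real.exp (l * x)) - 1 + γ₀ := by
  have : c0star J γ₀ ≤ ((∫ x, J x * Real.exp (l * x)) + γ₀ - 1) / l := by
    apply csInf_le
    · refine ⟨0, ?_⟩
      rintro _ ⟨m, hm, rfl⟩
      have := kmgf J hJ m
      have hm' : 0 < m := hm
      apply div_nonneg _ hm'.le
      linarith
    · exact ⟨l, hl, rfl⟩
  rw [le_div_iff₀ hl] at this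
  linarith

lemma kderiv (J : ℝ → ℝ) (hJ : IsKernel J) (l c γ₀ : ℝ) (hl : 0 < l)
    (h1 : (∫ x, J x * Real.exp (l * x)) - 1 + γ₀ = c * l)
    (h2 : ∀ m, 0 < m → c * m ≤ (∫ x, J x * Real.exp (m * x)) - 1 + γ₀) :
    ∫ x, J x * (x * Real.exp (l * x)) = c := by
  obtain ⟨r, hr, hr0⟩ := krad J hJ
  set m1 := ∫ x, J x * (x * Real.exp (l * x)) with hm1
  set m2 := ∫ x, J x * (x ^ 2 * Real.exp (l * x)) with hm2
  have key : ∀ h : ℝ, |h| * r ≤ 1 → -l < h → 0 ≤ h * (m1 - c) + h ^ 2 * m2 := by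
    intro h hh hlh
    have e := h2 (l + h) (by linarith)
    have : ∫ x, J x * Real.exp ((l + h) * x) ≤
        ∫ x, (J x * Real.exp (l * x) + h * (J x * (x * Real.exp (l * x)))
          + h ^ 2 * (J x * (x ^ 2 * Real.exp (l * x)))) := by
      apply integral_mono (kint' J hJ _ (by fun_prop))
      · exact ((kint' J hJ _ (by fun_prop)).add ((kint' J hJ _ (by fun_prop)).const_mul _)).add
          ((kint' J hJ _ (by fun_prop)).const_mul _)
      intro x
      by_cases hx : |x| ≤ r
      · have hb : |h * x| ≤ 1 := by
          rw [abs_mul]; exact (mul_le_mul_of_nonneg_left hx (abs_nonneg _)).trans hh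
        have t := (abs_le.1 (Real.abs_exp_sub_one_sub_id_le hb)).2
        have t2 : Real.exp ((l + h) * x) = Real.exp (l * x) * Real.exp (h * x) := by
          rw [← Real.exp_add]; congr 1; ring
        have t3 : Real.exp (h * x) ≤ 1 + h * x + (h * x) ^ 2 := by linarith
        have t4 := mul_le_mul_of_nonneg_left t3 (mul_nonneg (hJ.2.1 x) (Real.exp_pos (l * x)).le)
        simp only [t2]
        nlinarith [t4]
      · simp [hr0 x (not_le.1 hx)]
    have i0 := kint' J hJ (fun x => Real.exp (l * x)) (by fun_prop)
    have i1 := (kint' J hJ (fun x => x * Real.exp (l * x)) (by fun_prop)).const_mul h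
    have i2 := (kint' J hJ (fun x => x ^ 2 * Real.exp (l * x)) (by fun_prop)).const_mul (h ^ 2)
    have i01 : Integrable (fun x => J x * Real.exp (l * x) + h * (J x * (x * Real.exp (l * x)))) :=
      i0.add i1
    rw [integral_add i01 i2, integral_add i0 i1, integral_const_mul, integral_const_mul, ← hm1, ← hm2] at this
    nlinarith
  have hm20 : 0 ≤ m2 := by
    apply integral_nonneg
    intro x
    have := hJ.2.1 x
    have := Real.exp_pos (l * x)
    positivity
  by_contra hne
  have hd : m1 - c ≠ 0 := sub_ne_zero.2 hne
  set d := m1 - c with hdd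
  have hdpos : 0 < |d| := abs_pos.2 hd
  set t := min (1 / (|d| * r)) (min (l / (2 * |d|)) (1 / (2 * (m2 + 1)))) with ht
  have htpos : 0 < t := by positivity
  have ht1 : t * (|d| * r) ≤ 1 := by
    have := min_le_left (1 / (|d| * r)) (min (l / (2 * |d|)) (1 / (2 * (m2 + 1))))
    rw [← ht, le_div_iff₀ (by positivity)] at this
    exact this
  have ht2 : t * (2 * |d|) ≤ l := by
    have := (min_le_right (1 / (|d| * r)) (min (l / (2 * |d|)) (1 / (2 * (m2 + 1))))).trans (min_le_left _ _)
    rw [← ht, le_div_iff₀ (by positivity)] at this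
    exact this
  have ht3 : t * (2 * (m2 + 1)) ≤ 1 := by
    have := (min_le_right (1 / (|d| * r)) (min (l / (2 * |d|)) (1 / (2 * (m2 + 1))))).trans (min_le_right _ _)
    rw [← ht, le_div_iff₀ (by positivity)] at this
    exact this
  have hk := key (-(t * d)) (by rw [abs_neg, abs_mul, abs_of_pos htpos]; linarith)
    (by have := le_abs_self d; nlinarith)
  have hd2 : 0 < d ^ 2 := by positivity
  have : t * d ^ 2 * (t * m2 - 1) ≥ 0 := by nlinarith
  have h3 : t * m2 - 1 < 0 := by nlinarith
  have h4 : 0 < t * d ^ 2 := by positivity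
  nlinarith

lemma exp_der (m b ξ : ℝ) : HasDerivAt (fun x : ℝ => Real.exp (m * (x - b)))
    (m * Real.exp (m * (ξ - b))) ξ := by
  have h : HasDerivAt (fun x : ℝ => m * (x - b)) m ξ := by
    simpa using ((hasDerivAt_id' ξ).sub_const b).const_mul m
  have := h.exp
  rwa [mul_comm] at this

lemma cmpR (l M κ H r η : ℝ) (hl : 0 < l) (hM : 0 < M) (hκ : 0 < κ) (hη : 0 ≤ η)
    (hr : 0 < r)
    (hH : κ * Real.exp (κ * r) + (l + M) * Real.exp ((l + M) * r) ≤ H) (s : ℝ) (hs : |s| ≤ r) :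
    (0 ≤ s → Real.exp (M * s) - η ≤
      H * (s * Real.exp (-(l * s))) - η * Real.exp (-(l * s)) + Real.exp (-((l + κ) * s))) ∧
    (s ≤ 0 → H * (s * Real.exp (-(l * s))) - η * Real.exp (-(l * s)) + Real.exp (-((l + κ) * s))
      ≤ Real.exp (M * s) - η) := by
  set D : ℝ → ℝ := fun s => H * s - η + Real.exp (-(κ * s)) -
    (Real.exp ((l + M) * s) - η * Real.exp (l * s)) with hD
  have hder : ∀ s, HasDerivAt D (H + -κ * Real.exp (-(κ * s)) -
      ((l + M) * Real.exp ((l + M) * s) - η * (l * Real.exp (l * s)))) s := by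
    intro s
    have h1 : HasDerivAt (fun s : ℝ => Real.exp (-(κ * s))) (-κ * Real.exp (-(κ * s))) s := by
      simpa using exp_der (-κ) 0 s
    have h2 : HasDerivAt (fun s : ℝ => Real.exp ((l + M) * s))
        ((l + M) * Real.exp ((l + M) * s)) s := by
      simpa using exp_der (l + M) 0 s
    have h3 : HasDerivAt (fun s : ℝ => Real.exp (l * s)) (l * Real.exp (l * s)) s := by
      simpa using exp_der l 0 s
    have h4 : HasDerivAt (fun s : ℝ => H * s - η) H s := by
      simpa using ((hasDerivAt_id s).const_mul H).sub_const η
    exact (h4.add h1).sub (h2.sub (h3.const_mul η))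
  have hmono : MonotoneOn D (Icc (-r) r) := by
    apply monotoneOn_of_deriv_nonneg (convex_Icc _ _)
    · exact fun x _ => (hder x).continuousAt.continuousWithinAt
    · exact fun x _ => (hder x).differentiableAt.differentiableWithinAt
    · intro x hx
      rw [interior_Icc] at hx
      rw [(hder x).deriv]
      have e1 : κ * Real.exp (-(κ * x)) ≤ κ * Real.exp (κ * r) := by
        gcongr; nlinarith [hx.1]
      have e2 : (l + M) * Real.exp ((l + M) * x) ≤ (l + M) * Real.exp ((l + M) * r) := by
        gcongr; exact hx.2.le
      have e3 : 0 ≤ η * (l * Real.exp (l * x)) := by positivity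
      linarith
  have hD0 : D 0 = 0 := by simp [hD]; ring
  have hsI : s ∈ Icc (-r) r := abs_le.1 hs
  have h0I : (0:ℝ) ∈ Icc (-r) r := by constructor <;> linarith
  have hid : H * (s * Real.exp (-(l * s))) - η * Real.exp (-(l * s)) + Real.exp (-((l + κ) * s))
      - (Real.exp (M * s) - η) = Real.exp (-(l * s)) * D s := by
    have a1 : Real.exp (-((l + κ) * s)) = Real.exp (-(l * s)) * Real.exp (-(κ * s)) := by
      rw [← Real.exp_add]; congr 1; ring
    have a2 : Real.exp (M * s) = Real.exp (-(l * s)) * Real.exp ((l + M) * s) := by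
      rw [← Real.exp_add]; congr 1; ring
    have a3 : Real.exp (-(l * s)) * Real.exp (l * s) = 1 := by
      rw [← Real.exp_add]; simp
    rw [a1, a2]
    simp only [hD]
    linear_combination (-η) * a3
  constructor
  · intro h
    have := hmono h0I hsI h
    rw [hD0] at this
    have := mul_nonneg (Real.exp_pos (-(l * s))).le this
    linarith
  · intro h
    have := hmono hsI h0I h
    rw [hD0] at this
    have := mul_nonneg (Real.exp_pos (-(l * s))).le (neg_nonneg.2 this)
    linarith

/-- left correction -/
def RL (M η b : ℝ) (ξ : ℝ) : ℝ := Real.exp (M * (ξ - b)) - η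

/-- right correction -/
def RT (l κ H η b : ℝ) (ξ : ℝ) : ℝ :=
  H * ((ξ - b) * Real.exp (-(l * (ξ - b)))) - η * Real.exp (-(l * (ξ - b))) +
    Real.exp (-((l + κ) * (ξ - b)))

/-- glued correction -/
def RG (l κ H M η b : ℝ) (ξ : ℝ) : ℝ := if ξ ≤ b then RL M η b ξ else RT l κ H η b ξ

lemma RL_contDiff (M η b : ℝ) : ContDiff ℝ 1 (RL M η b) := by
  unfold RL; fun_prop

lemma RT_contDiff (l κ H η b : ℝ) : ContDiff ℝ 1 (RT l κ H η b) := by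
  unfold RT; fun_prop

lemma RG_cont (l κ H M η b : ℝ) : Continuous (RG l κ H M η b) := by
  unfold RG
  apply Continuous.if_le (RL_contDiff _ _ _).continuous (RT_contDiff _ _ _ _ _).continuous
    continuous_id continuous_const
  intro x hx
  simp only [id] at hx
  subst hx
  simp [RL, RT]; ring

lemma RL_b (M η b : ℝ) : RL M η b b = 1 - η := by simp [RL]
lemma RT_b (l κ H η b : ℝ) : RT l κ H η b b = 1 - η := by simp [RT]; ring

lemma RL_deriv (M η b ξ : ℝ) : HasDerivAt (RL M η b) (M * Real.exp (M * (ξ - b))) ξ := by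
  unfold RL
  exact (exp_der M b ξ).sub_const η

lemma RT_deriv (l κ H η b ξ : ℝ) : HasDerivAt (RT l κ H η b)
    (H * (Real.exp (-(l * (ξ - b))) - l * ((ξ - b) * Real.exp (-(l * (ξ - b))))) +
      η * l * Real.exp (-(l * (ξ - b))) - (l + κ) * Real.exp (-((l + κ) * (ξ - b)))) ξ := by
  have h1 : ∀ m : ℝ, HasDerivAt (fun ξ : ℝ => Real.exp (-(m * (ξ - b))))
      (-m * Real.exp (-(m * (ξ - b)))) ξ := by
    intro m
    simpa only [neg_mul] using exp_der (-m) b ξ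
  have h2 := (((hasDerivAt_id' ξ).sub_const b).mul (h1 l)).const_mul H
  have h3 := (h2.sub ((h1 l).const_mul η)).add (h1 (l + κ))
  refine HasDerivAt.congr_deriv h3 ?_
  ring

lemma RL_op (J : ℝ → ℝ) (hJ : IsKernel J) (c M η b ξ : ℝ) :
    c * M * Real.exp (M * (ξ - b)) ≤
    (∫ y, J (ξ - y) * RL M η b y) - RL M η b ξ + c * (M * Real.exp (M * (ξ - b))) := by
  have h := kexp J ξ b (-M)
  have e1 : ∫ y, J (ξ - y) * RL M η b y =
      (∫ y, J (ξ - y) * Real.exp (-(-M * (y - b)))) - η := by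
    have : (fun y => J (ξ - y) * RL M η b y) =
        fun y => J (ξ - y) * Real.exp (-(-M * (y - b))) - η * (J (ξ - y) * 1) := by
      ext y; unfold RL; rw [show -(-M * (y - b)) = M * (y - b) by ring]; ring
    rw [this, integral_sub (kint J hJ _ (by fun_prop) ξ)
      ((kint J hJ (fun _ => 1) (by fun_prop) ξ).const_mul η), integral_const_mul]
    simp [kone J hJ ξ]
  rw [e1, h]
  have hm := kmgf J hJ (-M)
  rw [show -(-M * (ξ - b)) = M * (ξ - b) by ring]
  have := mul_le_mul_of_nonneg_right hm (Real.exp_pos (M * (ξ - b))).le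
  unfold RL
  linarith

lemma RT_op (J : ℝ → ℝ) (hJ : IsKernel J) (c l γ κ H η b g ξ : ℝ)
    (hroot : (∫ x, J x * Real.exp (l * x)) - 1 + γ = c * l)
    (hm1 : ∫ x, J x * (x * Real.exp (l * x)) = c)
    (hg : (∫ x, J x * Real.exp ((l + κ) * x)) - 1 + γ = c * (l + κ) + g) :
    (∫ y, J (ξ - y) * RT l κ H η b y) - RT l κ H η b ξ +
      c * (H * (Real.exp (-(l * (ξ - b))) - l * ((ξ - b) * Real.exp (-(l * (ξ - b))))) +
      η * l * Real.exp (-(l * (ξ - b))) - (l + κ) * Real.exp (-((l + κ) * (ξ - b)))) =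
    -γ * RT l κ H η b ξ + g * Real.exp (-((l + κ) * (ξ - b))) := by
  have e1 : ∫ y, J (ξ - y) * RT l κ H η b y =
      H * (∫ y, J (ξ - y) * ((y - b) * Real.exp (-(l * (y - b))))) -
      η * (∫ y, J (ξ - y) * Real.exp (-(l * (y - b)))) +
      ∫ y, J (ξ - y) * Real.exp (-((l + κ) * (y - b))) := by
    have : (fun y => J (ξ - y) * RT l κ H η b y) = fun y =>
        (H * (J (ξ - y) * ((y - b) * Real.exp (-(l * (y - b))))) -
        η * (J (ξ - y) * Real.exp (-(l * (y - b))))) +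
        J (ξ - y) * Real.exp (-((l + κ) * (y - b))) := by
      ext y; unfold RT; ring
    have i1 := (kint J hJ (fun y => (y - b) * Real.exp (-(l * (y - b)))) (by fun_prop) ξ).const_mul H
    have i2 := (kint J hJ (fun y => Real.exp (-(l * (y - b)))) (by fun_prop) ξ).const_mul η
    rw [this, integral_add _ (kint J hJ _ (by fun_prop) ξ), integral_sub i1 i2, integral_const_mul,
      integral_const_mul]
    exact i1.sub i2
  rw [e1, kxexp J hJ, kexp, kexp, hm1]
  unfold RT
  have hr' : (∫ x, J x * Real.exp (l * x)) = c * l + 1 - γ := by linarith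
  have hg' : (∫ x, J x * Real.exp ((l + κ) * x)) = c * (l + κ) + g + 1 - γ := by linarith
  rw [hr', hg']
  ring

lemma RT_bounds (l κ H η b ξ : ℝ) (hκ : 0 < κ) (hH : κ ≤ H) (hη : 0 ≤ η) (hη1 : η ≤ 1)
    (hξ : b ≤ ξ) :
    0 ≤ RT l κ H η b ξ ∧
    RT l κ H η b ξ ≤ (1 + H * (ξ - b)) * Real.exp (-(l * (ξ - b))) := by
  have a1 : Real.exp (-((l + κ) * (ξ - b))) =
      Real.exp (-(l * (ξ - b))) * Real.exp (-(κ * (ξ - b))) := by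
    rw [← Real.exp_add]; congr 1; ring
  have hid : RT l κ H η b ξ = (H * (ξ - b) - η + Real.exp (-(κ * (ξ - b)))) *
      Real.exp (-(l * (ξ - b))) := by
    unfold RT; rw [a1]; ring
  have hs : 0 ≤ ξ - b := by linarith
  have e1 : Real.exp (-(κ * (ξ - b))) ≤ 1 := by
    apply Real.exp_le_one_iff.2; nlinarith
  have e2 := Real.add_one_le_exp (-(κ * (ξ - b)))
  have e3 : κ * (ξ - b) ≤ H * (ξ - b) := by gcongr
  rw [hid]
  constructor
  · apply mul_nonneg _ (Real.exp_pos _).le; linarith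
  · apply mul_le_mul_of_nonneg_right _ (Real.exp_pos _).le; linarith

lemma W_facts (J g : ℝ → ℝ) (c : ℝ) (W : ℝ → ℝ) (h : IsNLFront J g c W) :
    StrictAnti W ∧ (∀ x, 0 < W x) ∧ (∀ x, W x < 1) := by
  obtain ⟨h1, h2, h3, h4, h5⟩ := h
  have ha : StrictAnti W := strictAnti_of_deriv_neg h5
  refine ⟨ha, fun x => ?_, fun x => ?_⟩
  · have : 0 ≤ W (x + 1) := ha.antitone.le_of_tendsto h4 (x + 1)
    exact this.trans_lt (ha (by linarith))
  · have : W (x - 1) ≤ 1 := ha.antitone.ge_of_tendsto h3 (x - 1)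
    exact (ha (by linarith : x - 1 < x)).trans_le this

lemma W_upper (W : ℝ → ℝ) (l A₀ : ℝ) (hl : 0 < l)
    (hlim : Tendsto (fun ξ => W ξ / (ξ * Real.exp (-(l * ξ)))) atTop (nhds A₀))
    (τ : ℝ) (hτ : 0 < τ) :
    ∃ b : ℝ, ∀ ξ, b ≤ ξ → W ξ ≤ τ * Real.exp (-(3 * l / 4 * (ξ - b))) := by
  have h1 : Tendsto (fun ξ : ℝ => ξ * Real.exp (-(l / 4) * ξ)) atTop (nhds 0) := by
    have := Real.tendsto_pow_mul_exp_neg_atTop_nhds_zero 1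
    have h2 : Tendsto (fun ξ : ℝ => (l / 4) * ξ) atTop atTop :=
      tendsto_id.const_mul_atTop (by positivity)
    have h3 := (this.comp h2).const_mul (4 / l)
    simp only [mul_zero] at h3
    refine h3.congr fun x => ?_
    simp only [Function.comp, pow_one]
    rw [show -(l / 4 * x) = -(l / 4) * x by ring]
    field_simp
  have h2 := hlim.mul h1
  rw [mul_zero] at h2
  have h3 := (h2.eventually_lt_const hτ).and (eventually_ge_atTop 1)
  obtain ⟨b, hb⟩ := eventually_atTop.1 h3
  refine ⟨max b 0, fun ξ hξ => ?_⟩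
  obtain ⟨e1, e2⟩ := hb ξ ((le_max_left _ _).trans hξ)
  have e3 : W ξ / (ξ * Real.exp (-(l * ξ))) * (ξ * Real.exp (-(l / 4) * ξ)) =
      W ξ * Real.exp (3 * l / 4 * ξ) := by
    have : Real.exp (-(l / 4) * ξ) = Real.exp (-(l * ξ)) * Real.exp (3 * l / 4 * ξ) := by
      rw [← Real.exp_add]; congr 1; ring
    rw [this]
    have := Real.exp_pos (-(l * ξ))
    field_simp
  rw [e3] at e1
  have e4 : W ξ ≤ τ * Real.exp (-(3 * l / 4 * ξ)) := by
    rw [Real.exp_neg, ← div_eq_mul_inv, le_div_iff₀ (Real.exp_pos _)]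
    exact e1.le
  refine e4.trans ?_
  gcongr
  have := le_max_right b 0
  linarith

lemma W_lower (W : ℝ → ℝ) (hW : StrictAnti W) (hW0 : ∀ x, 0 < W x) (l A₀ : ℝ) (hl : 0 < l)
    (hA : 0 < A₀)
    (hlim : Tendsto (fun ξ => W ξ / (ξ * Real.exp (-(l * ξ)))) atTop (nhds A₀)) (b : ℝ) :
    ∃ k > 0, ∀ ξ, b ≤ ξ → k * ((1 + (ξ - b)) * Real.exp (-(l * (ξ - b)))) ≤ W ξ := by
  have h3 := (hlim.eventually_const_lt (half_lt_self hA)).and (eventually_ge_atTop 1)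
  obtain ⟨X, hX⟩ := eventually_atTop.1 h3
  set C := 2 + |b| with hC
  have hCp : 0 < C := by positivity
  set Y := max X b with hY
  have hYb : b ≤ Y := le_max_right _ _
  set k1 := A₀ / 2 / C * Real.exp (-(l * b)) with hk1
  set k2 := W Y / (1 + (Y - b)) with hk2
  have hYp : 0 < 1 + (Y - b) := by linarith
  have hk2p : 0 < k2 := div_pos (hW0 _) hYp
  refine ⟨min k1 k2, lt_min (by positivity) hk2p, fun ξ hξ => ?_⟩
  have hs : 0 ≤ ξ - b := by linarith
  rcases le_total ξ Y with h | h
  · have e1 : Real.exp (-(l * (ξ - b))) ≤ 1 := Real.exp_le_one_iff.2 (by nlinarith)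
    calc _ ≤ k2 * ((1 + (Y - b)) * 1) := by
          gcongr
          exact min_le_right _ _
      _ = W Y := by rw [hk2]; field_simp
      _ ≤ W ξ := hW.antitone h
  · obtain ⟨e1, e2⟩ := hX ξ ((le_max_left _ _).trans h)
    have hp : 0 < ξ * Real.exp (-(l * ξ)) := by positivity
    rw [lt_div_iff₀ hp] at e1
    refine le_trans ?_ e1.le
    have e3 : 1 + (ξ - b) ≤ C * ξ := by
      have := neg_abs_le b
      have := abs_nonneg b
      nlinarith
    have e4 : Real.exp (-(l * ξ)) = Real.exp (-(l * b)) * Real.exp (-(l * (ξ - b))) := by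
      rw [← Real.exp_add]; congr 1; ring
    calc _ ≤ k1 * ((C * ξ) * Real.exp (-(l * (ξ - b)))) := by
          gcongr
          exact min_le_left _ _
      _ = _ := by rw [e4, hk1]; field_simp

lemma crossing (u : ℝ → ℝ) (hu : StrictAnti u) (hc : Continuous u) (t b : ℝ) (ht : 1 < t)
    (hl : Tendsto u atBot (nhds t)) (hb : u b < 1) : ∃ x < b, u x = 1 := by
  obtain ⟨z, hz⟩ := (hl.eventually_const_lt ht).exists
  have hzb : z < b := by
    by_contra h
    have := hu.antitone (not_lt.1 h)
    linarith
  obtain ⟨x, hx, hx1⟩ := intermediate_value_Icc' hzb.le hc.continuousOn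
    (show (1:ℝ) ∈ Icc (u b) (u z) from ⟨hb.le, hz.le⟩)
  refine ⟨x, lt_of_le_of_ne hx.2 ?_, hx1⟩
  rintro rfl
  linarith

set_option maxHeartbeats 4000000 in
lemma core (J : ℝ → ℝ) (hJ : IsKernel J) (r : ℝ) (hr : 0 < r) (hr0 : ∀ x, r < |x| → J x = 0)
    (c l γ κ H η M b K a ρ ε D g N : ℝ) (F Ft W : ℝ → ℝ) (hW : IsNLFront J F c W)
    (hl : 0 < l) (hκ : 0 < κ) (hM : 0 < M) (hcM : c * M = K + 1)
    (hroot : (∫ x, J x * Real.exp (l * x)) - 1 + γ = c * l)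
    (hm1 : ∫ x, J x * (x * Real.exp (l * x)) = c)
    (hg : (∫ x, J x * Real.exp ((l + κ) * x)) - 1 + γ = c * (l + κ) + g)
    (hH : κ * Real.exp (κ * r) + (l + M) * Real.exp ((l + M) * r) ≤ H)
    (hη0 : 0 < η) (hη1 : η ≤ 1 / 2) (hε : 0 < ε) (hD : 0 ≤ D)
    (ha : 0 < a) (haK : a ≤ K) (hρ1 : ρ ≤ 1)
    (f1 : ∀ x y, 0 ≤ x → x ≤ y → y ≤ 1 → |F y - F x| ≤ K * (y - x))
    (f2 : ∀ x y, 1 - ρ ≤ x → x ≤ y → y ≤ 1 → F y - F x ≤ -a * (y - x))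
    (f3 : ∀ x y, 0 ≤ x → x ≤ y → y ≤ 1 → (γ - K * y) * (y - x) ≤ F y - F x)
    (t0 : ∀ w, 0 ≤ w → w ≤ 1 → Ft w ≤ F w + D)
    (t2 : ∀ w, 0 ≤ w → w ≤ 1 → Ft w ≤ F w + D * w ^ 2) (t1 : Ft 1 = 0)
    (w1 : ∀ ξ, b ≤ ξ → K * (1 + H * (ξ - b)) * W ξ ≤ g / 2 * Real.exp (-(κ * (ξ - b))))
    (w2 : ∀ ξ, b ≤ ξ → D * W ξ ^ 2 ≤ ε * g / 2 * Real.exp (-((l + κ) * (ξ - b))))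
    (w3 : ∀ ξ, b ≤ ξ → ε * (1 + H) * ((1 + (ξ - b)) * Real.exp (-(l * (ξ - b)))) ≤ W ξ)
    (w4 : ∀ ξ, ξ ≤ N → 1 - ρ / 2 ≤ W ξ)
    (hε1 : ε ≤ ρ / 2) (hD1 : D ≤ ε * η * a) (hD2 : D ≤ ε * Real.exp (M * (N - b)) / 2)
    (hηK : η * K ≤ Real.exp (M * (N - b)) / 2) :
    (∀ ξ, 0 ≤ min (W ξ - ε * RG l κ H M η b ξ) 1) ∧
    (∃ ξ, min (W ξ - ε * RG l κ H M η b ξ) 1 ≠ 0) ∧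
    ∃ S : Finset ℝ,
      ContDiffOn ℝ 1 (fun ξ => min (W ξ - ε * RG l κ H M η b ξ) 1) ((S : Set ℝ))ᶜ ∧
      (∀ ξ, ξ ∉ S →
        (∫ y, J (ξ - y) * min (W y - ε * RG l κ H M η b y) 1)
          - min (W ξ - ε * RG l κ H M η b ξ) 1 +
          c * deriv (fun ζ => min (W ζ - ε * RG l κ H M η b ζ) 1) ξ +
          Ft (min (W ξ - ε * RG l κ H M η b ξ) 1) ≤ 0) ∧
      (∀ ξ₀ ∈ S, ∃ dp dm : ℝ,
        HasDerivWithinAt (fun ζ => min (W ζ - ε * RG l κ H M η b ζ) 1) dp (Ioi ξ₀) ξ₀ ∧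
        HasDerivWithinAt (fun ζ => min (W ζ - ε * RG l κ H M η b ζ) 1) dm (Iio ξ₀) ξ₀ ∧
        dp ≤ dm) := by
  obtain ⟨hWa, hWp, hW1⟩ := W_facts J F c W hW
  obtain ⟨hWc, hWeq, hWbot, -, hWd⟩ := hW
  set V : ℝ → ℝ := fun ξ => min (W ξ - ε * RG l κ H M η b ξ) 1 with hV
  set uL : ℝ → ℝ := fun ξ => W ξ - ε * RL M η b ξ with huL
  set uT : ℝ → ℝ := fun ξ => W ξ - ε * RT l κ H η b ξ with huT
  have hWcont := hWc.continuous
  have hVc : Continuous V := (hWcont.sub ((RG_cont l κ H M η b).const_mul ε)).min continuous_const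
  have huLd : ContDiff ℝ 1 uL := hWc.sub (contDiff_const.mul (RL_contDiff M η b))
  have huTd : ContDiff ℝ 1 uT := hWc.sub (contDiff_const.mul (RT_contDiff l κ H η b))
  have hWder : ∀ ξ, HasDerivAt W (deriv W ξ) ξ := fun ξ =>
    (hWc.differentiable (by norm_num) ξ).hasDerivAt
  have hK : 0 < K := ha.trans_le haK
  have hHκ : κ + (l + M) ≤ H := by
    have e1 : κ * 1 ≤ κ * Real.exp (κ * r) := by
      gcongr; exact Real.one_le_exp (by positivity)
    have e2 : (l + M) * 1 ≤ (l + M) * Real.exp ((l + M) * r) := by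
      gcongr; exact Real.one_le_exp (by positivity)
    linarith
  have hHp : 0 < H := by linarith
  have hRTb := fun ξ (hξ : b ≤ ξ) =>
    RT_bounds l κ H η b ξ hκ (by linarith) hη0.le (by linarith) hξ
  have huLa : StrictAnti uL := by
    intro x y hxy
    have e1 := hWa hxy
    have e2 : Real.exp (M * (x - b)) ≤ Real.exp (M * (y - b)) := by gcongr
    simp only [huL, RL]
    nlinarith
  have huLb : uL b < 1 := by
    simp only [huL, RL_b]
    have := hW1 b
    nlinarith
  have huLlim : Tendsto uL atBot (nhds (1 + ε * η)) := by
    have e : Tendsto (fun x => M * (x - b)) atBot atBot :=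
      (tendsto_atBot_add_const_right _ (-b) tendsto_id).const_mul_atBot hM
    have e2 := hWbot.sub (((Real.tendsto_exp_atBot.comp e).sub_const η).const_mul ε)
    rw [show 1 - ε * (0 - η) = 1 + ε * η by ring] at e2
    exact e2
  obtain ⟨p, hpb, hp1⟩ := crossing uL huLa huLd.continuous _ b (by nlinarith [mul_pos hε hη0])
    huLlim huLb
  have hVL : ∀ ξ, ξ ≤ b → V ξ = min (uL ξ) 1 := by
    intro ξ hξ; simp only [hV, huL, RG, if_pos hξ]
  have hV1 : ∀ ξ, ξ ≤ p → V ξ = 1 := by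
    intro ξ hξ
    rw [hVL ξ (by linarith)]
    apply min_eq_right
    rw [← hp1]; exact huLa.antitone hξ
  have hV2 : ∀ ξ, p ≤ ξ → ξ ≤ b → V ξ = uL ξ := by
    intro ξ hξ hξb
    rw [hVL ξ hξb]
    apply min_eq_left
    rw [← hp1]; exact huLa.antitone hξ
  have hTb : uT b = uL b := by simp only [huT, huL, RL_b, RT_b]
  have hV3' : ∀ ξ, b ≤ ξ → RG l κ H M η b ξ = RT l κ H η b ξ := by
    intro ξ hξ
    rcases hξ.eq_or_lt with h | h
    · rw [← h]; simp [RG, RL_b, RT_b]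
    · simp [RG, not_le.2 h]
  have hV3 : ∀ ξ, b ≤ ξ → V ξ = uT ξ := by
    intro ξ hξ
    simp only [hV, huT, hV3' ξ hξ]
    apply min_eq_left
    have := mul_nonneg hε.le (hRTb ξ hξ).1
    have := hW1 ξ
    linarith
  have hVle1 : ∀ ξ, V ξ ≤ 1 := fun ξ => min_le_right _ _
  have hεW : ε ≤ W b := by
    have := w3 b le_rfl
    simp at this
    nlinarith
  have hV0 : ∀ ξ, 0 ≤ V ξ := by
    intro ξ
    rcases le_total ξ b with h | h
    · rw [hVL ξ h]
      apply le_min _ zero_le_one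
      apply le_trans _ (huLa.antitone h)
      simp only [huL, RL_b]
      nlinarith
    · rw [hV3 ξ h]
      have e1 := (hRTb ξ h).2
      have e2 := w3 ξ h
      have e3 : (1 + H * (ξ - b)) * Real.exp (-(l * (ξ - b))) ≤
          (1 + H) * ((1 + (ξ - b)) * Real.exp (-(l * (ξ - b)))) := by
        rw [← mul_assoc]
        gcongr
        nlinarith
      have e4 := mul_le_mul_of_nonneg_left (e1.trans e3) hε.le
      simp only [huT]
      linarith
  have hcmp := fun ξ (h : |ξ - b| ≤ r) => cmpR l M κ H r η hl hM hκ hη0.le hr hH (ξ - b) h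
  have hVuL : ∀ y, y ≤ b + r → V y ≤ uL y := by
    intro y hy
    rcases le_total y b with h | h
    · rw [hVL y h]; exact min_le_left _ _
    · rw [hV3 y h]
      have := (hcmp y (by rw [abs_le]; constructor <;> linarith)).1 (by linarith)
      have := mul_le_mul_of_nonneg_left this hε.le
      simp only [huT, huL, RL, RT]
      linarith
  have hVuT : ∀ y, b - r ≤ y → V y ≤ uT y := by
    intro y hy
    rcases le_total y b with h | h
    · rw [hVL y h]
      apply (min_le_left _ _).trans
      have := (hcmp y (by rw [abs_le]; constructor <;> linarith)).2 (by linarith)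
      have := mul_le_mul_of_nonneg_left this hε.le
      simp only [huT, huL, RL, RT]
      linarith
    · rw [hV3 y h]
  have hn1 : ∀ ξ, ξ < p → V =ᶠ[nhds ξ] fun _ => 1 := by
    intro ξ hξ
    filter_upwards [Iio_mem_nhds hξ] with y hy
    exact hV1 y (le_of_lt hy)
  have hn2 : ∀ ξ, p < ξ → ξ < b → V =ᶠ[nhds ξ] uL := by
    intro ξ hξ hξ'
    filter_upwards [Ioo_mem_nhds hξ hξ'] with y hy
    exact hV2 y hy.1.le hy.2.le
  have hn3 : ∀ ξ, b < ξ → V =ᶠ[nhds ξ] uT := by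
    intro ξ hξ
    filter_upwards [Ioi_mem_nhds hξ] with y hy
    exact hV3 y (le_of_lt hy)
  have huLder : ∀ ξ, HasDerivAt uL (deriv W ξ - ε * (M * Real.exp (M * (ξ - b)))) ξ := fun ξ =>
    (hWder ξ).sub ((RL_deriv M η b ξ).const_mul ε)
  have huTder : ∀ ξ, HasDerivAt uT (deriv W ξ - ε * (H * (Real.exp (-(l * (ξ - b))) -
      l * ((ξ - b) * Real.exp (-(l * (ξ - b))))) +
      η * l * Real.exp (-(l * (ξ - b))) - (l + κ) * Real.exp (-((l + κ) * (ξ - b))))) ξ := fun ξ =>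
    (hWder ξ).sub ((RT_deriv l κ H η b ξ).const_mul ε)
  refine ⟨hV0, ⟨p, ?_⟩, {p, b}, ?_, ?_, ?_⟩
  · have : V p = 1 := hV1 p le_rfl
    show V p ≠ 0
    rw [this]; exact one_ne_zero
  · intro ξ hξ
    simp only [Finset.coe_insert, Finset.coe_singleton, mem_compl_iff, mem_insert_iff,
      mem_singleton_iff, not_or] at hξ
    apply ContDiffAt.contDiffWithinAt
    rcases lt_or_gt_of_ne hξ.1 with h | h
    · exact contDiffAt_const.congr_of_eventuallyEq (hn1 ξ h)
    rcases lt_or_gt_of_ne hξ.2 with h' | h'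
    · exact huLd.contDiffAt.congr_of_eventuallyEq (hn2 ξ h h')
    · exact huTd.contDiffAt.congr_of_eventuallyEq (hn3 ξ h')
  · intro ξ hξ
    simp only [Finset.mem_insert, Finset.mem_singleton, not_or] at hξ
    show (∫ y, J (ξ - y) * V y) - V ξ + c * deriv V ξ + Ft (V ξ) ≤ 0
    rcases lt_or_gt_of_ne hξ.1 with h | h
    · rw [(hn1 ξ h).deriv_eq, hV1 ξ h.le, t1]
      have := kmono J hJ r hr0 V (fun _ => 1) hVc continuous_const ξ (fun y _ => hVle1 y)
      simp only [mul_one, kone J hJ] at this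
      simp
      linarith
    have hsplit : ∀ R : ℝ → ℝ, Continuous R → ∫ y, J (ξ - y) * (W y - ε * R y) =
        (∫ y, J (ξ - y) * W y) - ε * ∫ y, J (ξ - y) * R y := by
      intro R hR
      rw [← integral_const_mul, ← integral_sub (kint J hJ W hWcont ξ)
        ((kint J hJ R hR ξ).const_mul ε)]
      congr 1; ext y; ring
    have heq := hWeq ξ
    rcases lt_or_gt_of_ne hξ.2 with h' | h'
    · have hi := kmono J hJ r hr0 V uL hVc huLd.continuous ξ (fun y hy => by
        apply hVuL; have := (abs_le.1 hy).1; linarith)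
      rw [hsplit _ (RL_contDiff M η b).continuous] at hi
      have hop := RL_op J hJ c M η b ξ
      rw [hcM] at hop
      have hopε := mul_le_mul_of_nonneg_left hop hε.le
      rw [(hn2 ξ h h').deriv_eq, (huLder ξ).deriv]
      have hx0 := hV0 ξ
      have hx1 := hVle1 ξ
      rw [hV2 ξ h.le h'.le] at hx0 hx1 ⊢
      have ht := t0 (uL ξ) hx0 hx1
      set E := Real.exp (M * (ξ - b)) with hE
      have hEp : 0 < E := Real.exp_pos _
      have hux : uL ξ = W ξ - ε * (E - η) := rfl
      have hRLx : RL M η b ξ = E - η := rfl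
      rw [hRLx] at hopε
      have hw0 := (hWp ξ).le
      have hw1 := (hW1 ξ).le
      suffices hkey : F (uL ξ) - F (W ξ) + D ≤ ε * (K + 1) * E by
        linarith
      rcases le_total ξ N with hN | hN
      · have hwN := w4 ξ hN
        have hE1 : E ≤ 1 := by
          apply Real.exp_le_one_iff.2; nlinarith
        rcases le_total E η with hEη | hEη
        · have hle : W ξ ≤ uL ξ := by rw [hux]; nlinarith
          have q := f2 (W ξ) (uL ξ) (by linarith) hle hx1
          have q2 : uL ξ - W ξ = ε * (η - E) := by rw [hux]; ring
          rw [q2] at q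
          have q3 : ε * E * a ≤ ε * E * K := by gcongr
          have q4 : 0 < ε * E := by positivity
          linarith
        · have hle : uL ξ ≤ W ξ := by rw [hux]; nlinarith
          have q := f1 (uL ξ) (W ξ) hx0 hle hw1
          have q2 : W ξ - uL ξ = ε * (E - η) := by rw [hux]; ring
          rw [q2] at q
          have q1 := neg_abs_le (F (W ξ) - F (uL ξ))
          have q3 : ε * η * a ≤ ε * η * K := by gcongr
          have q4 : 0 < ε * E := by positivity
          linarith
      · have hEN : Real.exp (M * (N - b)) ≤ E := by rw [hE]; gcongr
        have q : F (uL ξ) - F (W ξ) ≤ K * (ε * (E + η)) := by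
          rcases le_total (uL ξ) (W ξ) with hle | hle
          · have q := f1 (uL ξ) (W ξ) hx0 hle hw1
            have q1 := neg_abs_le (F (W ξ) - F (uL ξ))
            have q2 : K * (W ξ - uL ξ) ≤ K * (ε * (E + η)) := by
              gcongr; rw [hux]; linarith [mul_pos hε hEp, mul_pos hε hη0]
            linarith
          · have q := f1 (W ξ) (uL ξ) hw0 hle hx1
            have q1 := le_abs_self (F (uL ξ) - F (W ξ))
            have q2 : K * (uL ξ - W ξ) ≤ K * (ε * (E + η)) := by
              gcongr; rw [hux]; linarith [mul_pos hε hEp, mul_pos hε hη0]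
            linarith
        have q3 : ε * (η * K) ≤ ε * (E / 2) := by gcongr; linarith
        have q4 : D ≤ ε * (E / 2) := by
          refine hD2.trans ?_
          rw [mul_div_assoc]; gcongr
        linarith
    · have hi := kmono J hJ r hr0 V uT hVc huTd.continuous ξ (fun y hy => by
        apply hVuT; have := (abs_le.1 hy).2; linarith)
      rw [hsplit _ (RT_contDiff l κ H η b).continuous] at hi
      have hop := RT_op J hJ c l γ κ H η b g ξ hroot hm1 hg
      have hopε := congrArg (fun z => ε * z) hop
      rw [(hn3 ξ h').deriv_eq, (huTder ξ).deriv]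
      have hx0 := hV0 ξ
      have hx1 := hVle1 ξ
      rw [hV3 ξ h'.le] at hx0 hx1 ⊢
      have ht := t2 (uT ξ) hx0 hx1
      obtain ⟨r0, r1⟩ := hRTb ξ h'.le
      have hux : uT ξ = W ξ - ε * RT l κ H η b ξ := rfl
      set Rx := RT l κ H η b ξ with hRx
      have hw0 := (hWp ξ).le
      have hw1 := (hW1 ξ).le
      have hεR := mul_nonneg hε.le r0
      have q := f3 (uT ξ) (W ξ) hx0 (by rw [hux]; linarith) hw1
      have qq : W ξ - uT ξ = ε * Rx := by rw [hux]; ring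
      rw [qq] at q
      have a1 : Real.exp (-((l + κ) * (ξ - b))) =
          Real.exp (-(l * (ξ - b))) * Real.exp (-(κ * (ξ - b))) := by
        rw [← Real.exp_add]; congr 1; ring
      have q1 : K * W ξ * Rx ≤ g / 2 * Real.exp (-((l + κ) * (ξ - b))) := by
        calc K * W ξ * Rx ≤ K * W ξ * ((1 + H * (ξ - b)) * Real.exp (-(l * (ξ - b)))) := by gcongr
          _ = (K * (1 + H * (ξ - b)) * W ξ) * Real.exp (-(l * (ξ - b))) := by ring
          _ ≤ (g / 2 * Real.exp (-(κ * (ξ - b)))) * Real.exp (-(l * (ξ - b))) :=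
            mul_le_mul_of_nonneg_right (w1 ξ h'.le) (Real.exp_pos _).le
          _ = _ := by rw [a1]; ring
      have q2 := mul_le_mul_of_nonneg_left q1 hε.le
      have q3 := w2 ξ h'.le
      have q4 : D * uT ξ ^ 2 ≤ D * W ξ ^ 2 := by
        gcongr; rw [hux]; linarith
      rw [hux] at ht q q4 ⊢
      linarith
  · intro ξ hξ
    simp only [Finset.mem_insert, Finset.mem_singleton] at hξ
    rcases hξ with rfl | rfl
    · refine ⟨deriv W ξ - ε * (M * Real.exp (M * (ξ - b))), 0, ?_, ?_, ?_⟩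
      · refine (huLder ξ).hasDerivWithinAt.congr_of_eventuallyEq ?_ (hV2 ξ le_rfl hpb.le)
        filter_upwards [Ioo_mem_nhdsGT hpb] with y hy
        exact hV2 y hy.1.le hy.2.le
      · refine (hasDerivWithinAt_const ξ (Iio ξ) (1:ℝ)).congr_of_eventuallyEq ?_ (hV1 ξ le_rfl)
        filter_upwards [self_mem_nhdsWithin] with y hy
        exact hV1 y (le_of_lt hy)
      · have := hWd ξ
        have : 0 < ε * (M * Real.exp (M * (ξ - b))) := by positivity
        linarith
    · refine ⟨_, _, (huTder ξ).hasDerivWithinAt.congr_of_eventuallyEq ?_ (hV3 ξ le_rfl),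
        (huLder ξ).hasDerivWithinAt.congr_of_eventuallyEq ?_ (hV2 ξ hpb.le le_rfl), ?_⟩
      · filter_upwards [self_mem_nhdsWithin] with y hy
        exact hV3 y (le_of_lt hy)
      · filter_upwards [Ioo_mem_nhdsLT hpb] with y hy
        exact hV2 y hy.1.le hy.2.le
      · have e1 := mul_pos hη0 hl
        have e2 : ε * M ≤ ε * (H + η * l - (l + κ)) := by
          apply mul_le_mul_of_nonneg_left _ hε.le
          linarith
        simp only [sub_self, mul_zero, zero_mul, neg_zero, Real.exp_zero, mul_one, sub_zero]
        linarith

set_option maxHeartbeats 4000000 in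
/-- Construction of a nonlocal super-solution: if the minimal front at the threshold
parameter `q*` decays like `A₀ ξ e^{-λ₀ξ}`, then after subtracting a suitable correction
`ℛ_w = O(ξ e^{-λ₀ξ})`, the truncation `min{𝒲* - ℛ_w, 1}` is a (broken) super-solution for
the parameter `q* + δ₀`, for every sufficiently small `δ₀ > 0`. -/
theorem supersolution_nonlocal
    (J : ℝ → ℝ) (hJ : IsKernel J)
    (f : ℝ → ℝ → ℝ) (γ₀ : ℝ) (hγ₀ : 0 < γ₀)
    (cNL : ℝ → ℝ) (q₁ q₂ : ℝ)
    -- (A1)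
    (hA1 : ∀ q, 0 ≤ q →
      ContDiffOn ℝ 2 (fun w => f w q) (Icc 0 1) ∧
      f 0 q = 0 ∧ f 1 q = 0 ∧
      derivWithin (fun w => f w q) (Icc 0 1) 0 = γ₀ ∧
      derivWithin (fun w => f w q) (Icc 0 1) 1 < 0 ∧
      (∀ w ∈ Ioo (0:ℝ) 1, 0 < f w q))
    -- (A2)
    (hA2 : ∃ L₀ > (0:ℝ), ∀ n : ℕ, n ≤ 2 → ∀ w ∈ Icc (0:ℝ) 1, ∀ qa qb : ℝ, 0 ≤ qa → 0 ≤ qb →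
      |iteratedDerivWithin n (fun w => f w qa) (Icc 0 1) w -
        iteratedDerivWithin n (fun w => f w qb) (Icc 0 1) w| ≤ L₀ * |qa - qb|)
    -- (A3)
    (hA3 : ∀ q qh : ℝ, 0 ≤ q → q < qh →
      (∀ w ∈ Ioo (0:ℝ) 1, f w q < f w qh) ∧
      iteratedDerivWithin 2 (fun w => f w q) (Icc 0 1) 0 <
        iteratedDerivWithin 2 (fun w => f w qh) (Icc 0 1) 0)
    -- minimal-speed characterization
    (hmin : ∀ q, 0 ≤ q → c0star J γ₀ ≤ cNL q ∧
      ∀ c, (∃ W : ℝ → ℝ, IsNLFront J (fun w => f w q) c W) ↔ cNL q ≤ c)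
    -- λ₀ is the unique positive number with ∫ J e^{λ₀ x} dx - 1 + γ₀ = c₀* λ₀
    (lam₀ : ℝ) (hlam₀ : 0 < lam₀)
    (hroot : (∫ x, J x * Real.exp (lam₀ * x)) - 1 + γ₀ = c0star J γ₀ * lam₀)
    (huniqroot : ∀ l, 0 < l →
      (∫ x, J x * Real.exp (l * x)) - 1 + γ₀ = c0star J γ₀ * l → l = lam₀)
    -- (A6)
    (hq₁ : 0 < q₁) (hA6 : ∀ w ∈ Icc (0:ℝ) 1, f w q₁ ≤ γ₀ * w)
    (hc₁ : cNL q₁ = c0star J γ₀)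
    -- (A7)
    (hq₂ : q₁ < q₂) (hc₂ : c0star J γ₀ < cNL q₂)
    -- the threshold value q* ∈ [q₁, q₂)
    (qstar : ℝ) (hqs₁ : q₁ ≤ qstar) (hqs₂ : qstar < q₂)
    (hthr₁ : ∀ q, 0 ≤ q → q ≤ qstar → cNL q = c0star J γ₀)
    (hthr₂ : ∀ q, qstar < q → c0star J γ₀ < cNL q)
    -- the minimal traveling wave at q*, with speed c₀*
    (Wstar : ℝ → ℝ) (hWstar : IsNLFront J (fun w => f w qstar) (c0star J γ₀) Wstar)
    -- the contradiction hypothesis: 𝒲*(ξ)/(ξ e^{-λ₀ξ}) → A₀ > 0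
    (A₀ : ℝ) (hA₀ : 0 < A₀)
    (hlim : Tendsto (fun ξ => Wstar ξ / (ξ * Real.exp (-(lam₀ * ξ)))) atTop (nhds A₀)) :
    ∃ R : ℝ → ℝ, Continuous R ∧
      (R =O[atTop] fun ξ => ξ * Real.exp (-(lam₀ * ξ))) ∧
      ∃ δmax > (0:ℝ), ∀ δ₀ : ℝ, 0 < δ₀ → δ₀ ≤ δmax →
        (∀ ξ, 0 ≤ min (Wstar ξ - R ξ) 1) ∧
        (∃ ξ, min (Wstar ξ - R ξ) 1 ≠ 0) ∧
        ∃ S : Finset ℝ,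
          ContDiffOn ℝ 1 (fun ξ => min (Wstar ξ - R ξ) 1) ((S : Set ℝ))ᶜ ∧
          (∀ ξ, ξ ∉ S →
            (∫ y, J (ξ - y) * min (Wstar y - R y) 1) - min (Wstar ξ - R ξ) 1 +
              c0star J γ₀ * deriv (fun ζ => min (Wstar ζ - R ζ) 1) ξ +
              f (min (Wstar ξ - R ξ) 1) (qstar + δ₀) ≤ 0) ∧
          (∀ ξ₀ ∈ S, ∃ dp dm : ℝ,
            HasDerivWithinAt (fun ζ => min (Wstar ζ - R ζ) 1) dp (Ioi ξ₀) ξ₀ ∧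
            HasDerivWithinAt (fun ζ => min (Wstar ζ - R ζ) 1) dm (Iio ξ₀) ξ₀ ∧
            dp ≤ dm) := by
  obtain ⟨L₀, hL, hA2⟩ := hA2
  have hqs : 0 ≤ qstar := by linarith
  obtain ⟨hF2, hF0, hF1, hFd0, hFd1, -⟩ := hA1 qstar hqs
  obtain ⟨K, a, ρ, ha, haK, hρ, hρ1, f1, f2, f3⟩ := f_facts (fun w => f w qstar) γ₀ hF2 hFd0 hFd1
  have hK : 0 < K := ha.trans_le haK
  obtain ⟨r, hr, hr0⟩ := krad J hJ
  have hc0 := fun m hm => c0_le J hJ γ₀ hγ₀ m hm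
  have hm1 := kderiv J hJ lam₀ _ γ₀ hlam₀ hroot hc0
  obtain ⟨hWa, hWp, hW1⟩ := W_facts J _ _ Wstar hWstar
  have hWbot := hWstar.2.2.1
  set c := c0star J γ₀ with hc
  have hcp : 0 < c := by
    have h1 := kmgf J hJ lam₀
    have : 0 < c * lam₀ := by linarith
    exact pos_of_mul_pos_left this hlam₀.le
  set l := lam₀ with hldef
  set κ := l / 2 with hκd
  have hκ : 0 < κ := by positivity
  set g := (∫ x, J x * Real.exp ((l + κ) * x)) - 1 + γ₀ - c * (l + κ) with hgd
  have hg : 0 < g := by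
    have h1 := hc0 (l + κ) (by positivity)
    rcases (sub_nonneg.2 h1).eq_or_lt with h | h
    · exfalso
      have := huniqroot (l + κ) (by positivity) (by linarith)
      linarith
    · exact h
  set M := (K + 1) / c with hMd
  have hM : 0 < M := by positivity
  have hcM : c * M = K + 1 := by rw [hMd]; field_simp
  set H := κ * Real.exp (κ * r) + (l + M) * Real.exp ((l + M) * r) with hHd
  have hH : 0 < H := by positivity
  set C := 1 + 4 * H / l with hCd
  have hC : 0 < C := by positivity
  set τ := g / (2 * K * C) with hτd
  have hτ : 0 < τ := by positivity
  obtain ⟨b, hb⟩ := W_upper Wstar l A₀ hlam₀ hlim τ hτ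
  obtain ⟨k, hk, hlow⟩ := W_lower Wstar hWa hWp l A₀ hlam₀ hA₀ hlim b
  obtain ⟨N, hN⟩ := eventually_atBot.1
    (hWbot.eventually_const_lt (show 1 - ρ / 2 < 1 by linarith))
  set E := Real.exp (M * (N - b)) with hEd
  have hE : 0 < E := Real.exp_pos _
  set η := min (1 / 2) (E / (2 * K)) with hηd
  have hη : 0 < η := by positivity
  have hη1 : η ≤ 1 / 2 := min_le_left _ _
  have hηK : η * K ≤ E / 2 := by
    have : η ≤ E / (2 * K) := min_le_right _ _
    rw [le_div_iff₀ (by positivity)] at this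
    linarith
  set ε := min (ρ / 2) (k / (1 + H)) with hεd
  have hε : 0 < ε := by positivity
  have hε1 : ε ≤ ρ / 2 := min_le_left _ _
  have hεk : ε * (1 + H) ≤ k := by
    have : ε ≤ k / (1 + H) := min_le_right _ _
    rwa [le_div_iff₀ (by positivity)] at this
  set δm := min (ε * η * a / L₀) (min (ε * E / 2 / L₀) (ε * g / 2 / (τ ^ 2 * L₀))) with hδd
  have hδm : 0 < δm := by positivity
  refine ⟨fun ξ => ε * RG l κ H M η b ξ, (RG_cont l κ H M η b).const_mul ε, ?_, δm, hδm, ?_⟩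
  · apply IsBigO.const_mul_left
    apply IsBigO.of_bound ((1 + H * (1 + |b|)) * Real.exp (l * b))
    filter_upwards [eventually_gt_atTop b, eventually_ge_atTop 1] with ξ h1 h2
    have hκH : κ ≤ H := by
      have e1 : κ * 1 ≤ κ * Real.exp (κ * r) := by
        gcongr; exact Real.one_le_exp (by positivity)
      have e2 : 0 ≤ (l + M) * Real.exp ((l + M) * r) := by positivity
      linarith
    obtain ⟨r0, r1⟩ := RT_bounds l κ H η b ξ hκ hκH hη.le (by linarith) h1.le
    have hp : 0 ≤ ξ * Real.exp (-(l * ξ)) := by positivity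
    simp only [RG, if_neg (not_le.2 h1)]
    rw [Real.norm_of_nonneg r0, Real.norm_of_nonneg hp]
    refine r1.trans ?_
    have e4 : Real.exp (-(l * (ξ - b))) = Real.exp (l * b) * Real.exp (-(l * ξ)) := by
      rw [← Real.exp_add]; congr 1; ring
    have e5 : 1 + H * (ξ - b) ≤ (1 + H * (1 + |b|)) * ξ := by
      have h3 := neg_abs_le b
      have h4 := abs_nonneg b
      have h5 : ξ - b ≤ (1 + |b|) * ξ := by nlinarith
      have h6 := mul_le_mul_of_nonneg_left h5 hH.le
      nlinarith
    rw [e4]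
    calc _ ≤ ((1 + H * (1 + |b|)) * ξ) * (Real.exp (l * b) * Real.exp (-(l * ξ))) := by gcongr
      _ = _ := by ring
  · intro δ hδ0 hδ
    have hq : 0 ≤ qstar + δ := by linarith
    obtain ⟨hG2, hG0, hG1, hGd0, -, -⟩ := hA1 (qstar + δ) hq
    have habs : |qstar + δ - qstar| = δ := by
      rw [add_sub_cancel_left, abs_of_pos hδ0]
    have d1 : L₀ * δ ≤ ε * η * a := by
      have := hδ.trans (min_le_left _ _)
      rw [le_div_iff₀ hL] at this
      linarith
    have d2 : L₀ * δ ≤ ε * E / 2 := by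
      have := hδ.trans ((min_le_right _ _).trans (min_le_left _ _))
      rw [le_div_iff₀ hL] at this
      linarith
    have d3 : L₀ * δ * τ ^ 2 ≤ ε * g / 2 := by
      have := hδ.trans ((min_le_right _ _).trans (min_le_right _ _))
      rw [le_div_iff₀ (by positivity)] at this
      linarith
    refine core J hJ r hr hr0 c l γ₀ κ H η M b K a ρ ε (L₀ * δ) g N (fun w => f w qstar)
      (fun w => f w (qstar + δ)) Wstar hWstar hlam₀ hκ hM hcM hroot hm1 (by rw [hgd]; ring)
      le_rfl hη hη1 hε (by positivity) ha haK hρ1 f1 f2 f3 ?_ ?_ hG1 ?_ ?_ ?_ ?_ hε1 d1 d2 hηK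
    · intro w h0 h1
      have := hA2 0 (by norm_num) w ⟨h0, h1⟩ (qstar + δ) qstar hq hqs
      simp only [iteratedDerivWithin_zero, habs] at this
      have := (abs_le.1 this).2
      linarith
    · intro w h0 h1
      refine f_diff (fun w => f w (qstar + δ)) (fun w => f w qstar) γ₀ (L₀ * δ) hG2 hF2 hG0 hF0
        hGd0 hFd0 ?_ w h0 h1
      intro x hx
      have := hA2 2 le_rfl x hx (qstar + δ) qstar hq hqs
      rwa [habs] at this
    · intro ξ hξ
      have hs : 0 ≤ ξ - b := by linarith
      have e1 := hb ξ hξ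
      have e2 : Real.exp (-(3 * l / 4 * (ξ - b))) =
          Real.exp (-(l / 4 * (ξ - b))) * Real.exp (-(κ * (ξ - b))) := by
        rw [← Real.exp_add]; congr 1; rw [hκd]; ring
      have e3 : (1 + H * (ξ - b)) * Real.exp (-(l / 4 * (ξ - b))) ≤ C := by
        rw [Real.exp_neg, ← div_eq_mul_inv, div_le_iff₀ (Real.exp_pos _)]
        have e4 := Real.add_one_le_exp (l / 4 * (ξ - b))
        have e5 : (1:ℝ) ≤ Real.exp (l / 4 * (ξ - b)) := Real.one_le_exp (by positivity)
        have e6 : H * (ξ - b) = 4 * H / l * (l / 4 * (ξ - b)) := by field_simp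
        have e7 : 4 * H / l * (l / 4 * (ξ - b)) ≤ 4 * H / l * Real.exp (l / 4 * (ξ - b)) := by
          gcongr; linarith
        rw [hCd, e6]; linarith
      calc K * (1 + H * (ξ - b)) * Wstar ξ
          ≤ K * (1 + H * (ξ - b)) * (τ * Real.exp (-(3 * l / 4 * (ξ - b)))) := by gcongr
        _ = K * τ * ((1 + H * (ξ - b)) * Real.exp (-(l / 4 * (ξ - b)))) *
            Real.exp (-(κ * (ξ - b))) := by rw [e2]; ring
        _ ≤ K * τ * C * Real.exp (-(κ * (ξ - b))) := by gcongr
        _ = _ := by rw [hτd]; field_simp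
    · intro ξ hξ
      have e1 := hb ξ hξ
      have e2 : Real.exp (-((l + κ) * (ξ - b))) = Real.exp (-(3 * l / 4 * (ξ - b))) ^ 2 := by
        rw [← Real.exp_nat_mul]; congr 1; rw [hκd]; push_cast; ring
      have hw := (hWp ξ).le
      calc L₀ * δ * Wstar ξ ^ 2
          ≤ L₀ * δ * (τ * Real.exp (-(3 * l / 4 * (ξ - b)))) ^ 2 := by gcongr
        _ = L₀ * δ * τ ^ 2 * Real.exp (-((l + κ) * (ξ - b))) := by rw [e2]; ring
        _ ≤ _ := by gcongr
    · intro ξ hξ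
      have hs : 0 ≤ ξ - b := by linarith
      refine le_trans ?_ (hlow ξ hξ)
      gcongr
    · intro ξ hξ
      exact (hN ξ hξ).le
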